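/- Let M ≥ 2 and k ≥ 3 be integers such that the critical strip S_M^k exists, i.e. q_{M+1}·k + (M+2)·log 3 < q_M·k − (M+1)·log 3, and for T > 0 let N_M^k(T) denote the number of zeros ρ of ζ^(k) (i.e. of iteratedDeriv k riemannZeta) with q_M·k − (M+1)·log 3 ≤ Re(ρ) ≤ q_M·k + (M+1)·log 3 and 0 < Im(ρ) ≤ T. Then there exists a constant C such that for all T > 0, |N_M^k(T) − T·(log(M+1) − log M)/(2π)| ≤ C. -/

import Mathlib

/-- `q M = log(log M / log(M+1)) / log(M/(M+1))`, the slope of the `M`-th critical line. -/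
noncomputable def q (M : ℕ) : ℝ :=
  Real.log (Real.log M / Real.log ((M : ℝ) + 1)) / Real.log ((M : ℝ) / ((M : ℝ) + 1))


noncomputable def mobD (a z : ℂ) : ℂ := (a - z) / (1 - (starRingEnd ℂ) a * z)

lemma mobD_den_ne {a z : ℂ} (ha : ‖a‖ < 1) (hz : ‖z‖ < 1) : 1 - (starRingEnd ℂ) a * z ≠ 0 := by
  intro h
  have h1 : (starRingEnd ℂ) a * z = 1 := (sub_eq_zero.mp h).symm
  have h2 : ‖a‖ * ‖z‖ = 1 := by
    rw [← RCLike.norm_conj a, ← norm_mul, h1, norm_one]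
  nlinarith [norm_nonneg a, norm_nonneg z]

lemma mobD_sq_id (a z : ℂ) :
    ‖1 - (starRingEnd ℂ) a * z‖ ^ 2 - ‖a - z‖ ^ 2 = (1 - ‖a‖ ^ 2) * (1 - ‖z‖ ^ 2) := by
  simp only [← Complex.normSq_eq_norm_sq, Complex.normSq_apply, Complex.sub_re, Complex.sub_im,
    Complex.mul_re, Complex.mul_im, Complex.conj_re, Complex.conj_im, Complex.one_re,
    Complex.one_im]
  ring

lemma mobD_norm_lt {a z : ℂ} (ha : ‖a‖ < 1) (hz : ‖z‖ < 1) : ‖mobD a z‖ < 1 := by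
  have h0 := mobD_den_ne ha hz
  rw [mobD, norm_div, div_lt_one (norm_pos_iff.mpr h0)]
  have h := mobD_sq_id a z
  have : 0 < (1 - ‖a‖ ^ 2) * (1 - ‖z‖ ^ 2) := by
    apply mul_pos <;> nlinarith [norm_nonneg a, norm_nonneg z]
  exact lt_of_pow_lt_pow_left₀ 2 (norm_nonneg _) (by linarith)

lemma mobD_invol {a z : ℂ} (ha : ‖a‖ < 1) (hz : ‖z‖ < 1) : mobD a (mobD a z) = z := by
  have h0 := mobD_den_ne ha hz
  have h1 := mobD_den_ne ha (mobD_norm_lt ha hz)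
  have e : a - mobD a z = z * (1 - (starRingEnd ℂ) a * mobD a z) := by
    have e0 : mobD a z * (1 - (starRingEnd ℂ) a * z) = a - z := div_mul_cancel₀ _ h0
    linear_combination -e0
  rw [mobD, e, mul_div_assoc, div_self h1, mul_one]

lemma schwarz_pick {g : ℂ → ℂ} (hg : DifferentiableOn ℂ g (Metric.ball 0 1))
    (hm : Set.MapsTo g (Metric.ball 0 1) (Metric.ball 0 1)) {a z : ℂ} (ha : ‖a‖ < 1)
    (hz : ‖z‖ < 1) : ‖mobD (g a) (g z)‖ ≤ ‖mobD a z‖ := by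
  have hga : ‖g a‖ < 1 := by simpa using hm (by simpa using ha : a ∈ Metric.ball (0:ℂ) 1)
  have hdm : ∀ b : ℂ, ‖b‖ < 1 → DifferentiableOn ℂ (mobD b) (Metric.ball 0 1) := by
    intro b hb w hw
    have hw' : ‖w‖ < 1 := by simpa using hw
    apply DifferentiableAt.differentiableWithinAt
    unfold mobD
    have := mobD_den_ne hb hw'
    fun_prop (disch := assumption)
  have hmm : ∀ b : ℂ, ‖b‖ < 1 → Set.MapsTo (mobD b) (Metric.ball 0 1) (Metric.ball 0 1) := by
    intro b hb w hw
    have hw' : ‖w‖ < 1 := by simpa using hw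
    simpa using mobD_norm_lt hb hw'
  have hd : DifferentiableOn ℂ (fun u => mobD (g a) (g (mobD a u))) (Metric.ball 0 1) :=
    (hdm _ hga).comp (hg.comp (hdm a ha) (hmm a ha)) (hm.comp (hmm a ha))
  have hM : Set.MapsTo (fun u => mobD (g a) (g (mobD a u))) (Metric.ball 0 1) (Metric.ball 0 1) :=
    (hmm _ hga).comp (hm.comp (hmm a ha))
  have h0 : (fun u => mobD (g a) (g (mobD a u))) 0 = 0 := by simp [mobD]
  have hu := mobD_norm_lt ha hz
  have := Complex.norm_le_norm_of_mapsTo_ball hd (hM.mono_right Metric.ball_subset_closedBall) h0 hu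
  simpa [mobD_invol ha hz] using this

lemma mobD_scale {r : ℝ} (h0 : 0 < r) (h1 : r < 1) {x y : ℂ} (hx : ‖x‖ < 1) (hy : ‖y‖ < 1)
    (hxy : x ≠ y) : ‖mobD (r * x) (r * y)‖ < ‖mobD x y‖ := by
  have hrx : ‖(r : ℂ) * x‖ < 1 := by
    rw [norm_mul, Complex.norm_real, Real.norm_of_nonneg h0.le]; nlinarith [norm_nonneg x]
  have hry : ‖(r : ℂ) * y‖ < 1 := by
    rw [norm_mul, Complex.norm_real, Real.norm_of_nonneg h0.le]; nlinarith [norm_nonneg y]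
  have d1 := mobD_den_ne hx hy
  have d2 := mobD_den_ne hrx hry
  rw [mobD, mobD, norm_div, norm_div, div_lt_div_iff₀ (norm_pos_iff.mpr d2) (norm_pos_iff.mpr d1)]
  have e1 : (r : ℂ) * x - r * y = r * (x - y) := by ring
  rw [e1, norm_mul, Complex.norm_real, Real.norm_of_nonneg h0.le]
  have hpos : 0 < ‖x - y‖ := norm_pos_iff.mpr (sub_ne_zero.mpr hxy)
  have key : r * ‖1 - (starRingEnd ℂ) x * y‖ < ‖1 - (starRingEnd ℂ) (r * x) * (r * y)‖ := by
    apply lt_of_pow_lt_pow_left₀ 2 (norm_nonneg _)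
    have hu : ‖(starRingEnd ℂ) x * y‖ < 1 := by
      rw [norm_mul, RCLike.norm_conj]; nlinarith [norm_nonneg x, norm_nonneg y]
    have e2 : (starRingEnd ℂ) (r * x) * (r * y) = (r : ℂ) ^ 2 * ((starRingEnd ℂ) x * y) := by
      rw [map_mul, Complex.conj_ofReal]; ring
    rw [e2]
    generalize (starRingEnd ℂ) x * y = u at hu
    have e3 : ‖1 - (r : ℂ) ^ 2 * u‖ ^ 2 - (r * ‖1 - u‖) ^ 2 = (1 - r ^ 2) * (1 - r ^ 2 * ‖u‖ ^ 2) := by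
      rw [mul_pow, ← Complex.ofReal_pow]
      simp only [← Complex.normSq_eq_norm_sq, Complex.normSq_apply, Complex.sub_re, Complex.sub_im,
        Complex.mul_re, Complex.mul_im, Complex.ofReal_re, Complex.ofReal_im, Complex.one_re,
        Complex.one_im]
      ring
    have : 0 < (1 - r ^ 2) * (1 - r ^ 2 * ‖u‖ ^ 2) := by
      have hr2 : r ^ 2 < 1 := by nlinarith
      have hu2 : ‖u‖ ^ 2 < 1 := by nlinarith [norm_nonneg u]
      apply mul_pos <;> nlinarith [sq_nonneg r, sq_nonneg ‖u‖]
    linarith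
  nlinarith

lemma fixed_unit {f : ℂ → ℂ} {r : ℝ} (h0 : 0 ≤ r) (h1 : r < 1)
    (hf : DifferentiableOn ℂ f (Metric.ball 0 1))
    (hm : ∀ z : ℂ, ‖z‖ < 1 → ‖f z‖ ≤ r) : ∃! z : ℂ, ‖z‖ < 1 ∧ f z = z := by
  set t := (r + 1) / 2 with ht
  have t0 : 0 < t := by linarith
  have t1 : t < 1 := by linarith
  have rt : r < t := by linarith
  have tc : (t : ℂ) ≠ 0 := by exact_mod_cast t0.ne'
  have hgn : ∀ z : ℂ, ‖z‖ < 1 → ‖f z / t‖ < 1 := by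
    intro z hz
    rw [norm_div, Complex.norm_real, Real.norm_of_nonneg t0.le, div_lt_one t0]
    exact (hm z hz).trans_lt rt
  have strict : ∀ a b : ℂ, ‖a‖ < 1 → ‖b‖ < 1 → a ≠ b → ‖mobD (f a) (f b)‖ < ‖mobD a b‖ := by
    intro a b ha hb hab
    have sp := schwarz_pick (g := fun z => f z / t) (hf.div_const _)
      (fun z hz => by simpa using hgn z (by simpa using hz)) ha hb
    by_cases hfe : f a = f b
    · have : mobD (f a) (f b) = 0 := by simp [mobD, hfe]
      rw [this, norm_zero, norm_pos_iff, mobD]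
      exact div_ne_zero (sub_ne_zero.mpr hab) (mobD_den_ne ha hb)
    · have := mobD_scale t0 t1 (hgn a ha) (hgn b hb) (by
        intro h; apply hfe; field_simp at h; exact h)
      rw [mul_div_cancel₀ _ tc, mul_div_cancel₀ _ tc] at this
      exact this.trans_le sp
  have hcont : ContinuousOn (fun z => ‖mobD z (f z)‖) (Metric.closedBall 0 r) := by
    have hfc : ContinuousOn f (Metric.closedBall 0 r) :=
      hf.continuousOn.mono (Metric.closedBall_subset_ball h1)
    apply ContinuousOn.norm
    unfold mobD
    apply ContinuousOn.div
    · fun_prop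
    · apply continuousOn_const.sub
      exact (Complex.continuous_conj.continuousOn).mul hfc
    · intro z hz
      have hz' : ‖z‖ < 1 := (by simpa using hz : ‖z‖ ≤ r).trans_lt h1
      exact mobD_den_ne hz' ((hm z hz').trans_lt h1)
  obtain ⟨z, hz, hmin⟩ := (isCompact_closedBall (0:ℂ) r).exists_isMinOn
    (Metric.nonempty_closedBall.mpr h0) hcont
  have hz' : ‖z‖ < 1 := (by simpa using hz : ‖z‖ ≤ r).trans_lt h1
  refine ⟨z, ⟨hz', ?_⟩, ?_⟩
  · by_contra hne
    have h2 := hmin (by simpa using hm z hz' : f z ∈ Metric.closedBall (0:ℂ) r)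
    have h3 := strict z (f z) hz' ((hm z hz').trans_lt h1) (Ne.symm hne)
    exact absurd h3 (not_lt.mpr h2)
  · rintro y ⟨hy, hfy⟩
    by_contra hne
    have hfz : f z = z := by
      by_contra hne
      have h2 := hmin (by simpa using hm z hz' : f z ∈ Metric.closedBall (0:ℂ) r)
      have h3 := strict z (f z) hz' ((hm z hz').trans_lt h1) (Ne.symm hne)
      exact absurd h3 (not_lt.mpr h2)
    have := strict y z hy hz' hne
    rw [hfy, hfz] at this
    exact lt_irrefl _ this

lemma fixed_ball {f : ℂ → ℂ} {c : ℂ} {r R : ℝ} (h0 : 0 ≤ r) (h1 : r < R)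
    (hf : DifferentiableOn ℂ f (Metric.ball c R))
    (hm : ∀ z : ℂ, ‖z - c‖ < R → ‖f z - c‖ ≤ r) : ∃! z : ℂ, ‖z - c‖ < R ∧ f z = z := by
  have R0 : 0 < R := h0.trans_lt h1
  have Rc : (R : ℂ) ≠ 0 := by exact_mod_cast R0.ne'
  have hn : ∀ u : ℂ, ‖u‖ < 1 → ‖(c + R * u) - c‖ < R := by
    intro u hu
    rw [add_sub_cancel_left, norm_mul, Complex.norm_real, Real.norm_of_nonneg R0.le]
    nlinarith
  obtain ⟨u, ⟨hu, hfu⟩, huniq⟩ := fixed_unit (f := fun u => (f (c + R * u) - c) / R) (r := r / R)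
    (by positivity) ((div_lt_one R0).mpr h1)
    (by
      apply DifferentiableOn.div_const
      apply DifferentiableOn.sub_const
      apply hf.comp (by fun_prop)
      intro u hu
      rw [mem_ball_iff_norm]
      exact hn u (by simpa using hu))
    (by
      intro z hz
      rw [norm_div, Complex.norm_real, Real.norm_of_nonneg R0.le]
      gcongr
      exact hm _ (hn z hz))
  refine ⟨c + R * u, ⟨hn u hu, ?_⟩, ?_⟩
  · have : (f (c + R * u) - c) / R = u := hfu
    rw [div_eq_iff Rc] at this
    linear_combination this
  · rintro y ⟨hy, hfy⟩
    have e : c + R * ((y - c) / R) = y := by field_simp; ring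
    have := huniq ((y - c) / R) ⟨by
      rw [norm_div, Complex.norm_real, Real.norm_of_nonneg R0.le, div_lt_one R0]; exact hy, by
      simp only [e, hfy]⟩
    rw [← this, e]

noncomputable def cc (n : ℕ) (θ : ℝ) : ℝ := (1 - θ) * Real.log n + θ * Real.log ((n : ℝ) + 1)

noncomputable def dl (n : ℕ) : ℝ := Real.log ((n : ℝ) + 1) - Real.log n

lemma logn_pos {n : ℕ} (hn : 2 ≤ n) : 0 < Real.log n :=
  Real.log_pos (by exact_mod_cast hn)

lemma dl_pos {n : ℕ} (hn : 1 ≤ n) : 0 < dl n := by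
  have : (0:ℝ) < n := by exact_mod_cast hn
  exact sub_pos.mpr (Real.log_lt_log this (by linarith))

lemma dl_eq {n : ℕ} (hn : 1 ≤ n) : dl n = -Real.log ((n : ℝ) / ((n : ℝ) + 1)) := by
  have : (0:ℝ) < n := by exact_mod_cast hn
  rw [Real.log_div this.ne' (by positivity), dl]; ring

lemma dl_gt {n : ℕ} (hn : 1 ≤ n) : 1 < ((n : ℝ) + 1) * dl n := by
  have h0 : (0:ℝ) < n := by exact_mod_cast hn
  have h := Real.log_lt_sub_one_of_pos (x := (n : ℝ) / (n + 1)) (by positivity)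
    (by intro h; rw [div_eq_one_iff_eq (by positivity)] at h; linarith)
  rw [dl_eq hn]
  have : (n : ℝ) / (n + 1) - 1 = - (1 / (n + 1)) := by field_simp; ring
  rw [this] at h
  have h2 : 1 / ((n : ℝ) + 1) < -Real.log ((n : ℝ) / ((n : ℝ) + 1)) := by linarith
  rw [div_lt_iff₀ (by positivity)] at h2
  linarith

lemma dl_anti {n : ℕ} (hn : 1 ≤ n) : dl (n + 1) ≤ dl n := by
  have h0 : (0:ℝ) < n := by exact_mod_cast hn
  rw [dl_eq hn, dl_eq (by omega)]
  apply neg_le_neg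
  apply Real.log_le_log (by positivity)
  push_cast
  rw [div_le_div_iff₀ (by positivity) (by positivity)]
  nlinarith

lemma dl_half {n : ℕ} (hn : 1 ≤ n) : dl n ≤ 2 * dl (n + 1) := by
  have h0 : (1:ℝ) ≤ n := by exact_mod_cast hn
  rw [dl_eq hn, dl_eq (by omega)]
  have : 2 * -Real.log (((n + 1 : ℕ) : ℝ) / (((n + 1 : ℕ) : ℝ) + 1)) =
      - Real.log ((((n + 1 : ℕ) : ℝ) / (((n + 1 : ℕ) : ℝ) + 1)) ^ 2) := by
    rw [Real.log_pow]; push_cast; ring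
  rw [this]
  apply neg_le_neg
  apply Real.log_le_log (by positivity)
  push_cast
  rw [div_pow, div_le_div_iff₀ (by positivity) (by positivity)]
  nlinarith

lemma logn_half {n : ℕ} (hn : 2 ≤ n) : Real.log ((n : ℝ) + 2) ≤ 2 * Real.log n := by
  have h0 : (2:ℝ) ≤ n := by exact_mod_cast hn
  have : 2 * Real.log (n : ℝ) = Real.log ((n : ℝ) ^ 2) := by rw [Real.log_pow]; push_cast; ring
  rw [this]
  apply Real.log_le_log (by positivity)
  nlinarith

lemma cc_succ (n : ℕ) (θ : ℝ) : cc (n + 1) θ - cc n θ = (1 - θ) * dl n + θ * dl (n + 1) := by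
  simp only [cc, dl]; push_cast; ring

lemma cc_pos {n : ℕ} (hn : 2 ≤ n) {θ : ℝ} (h0 : 0 ≤ θ) (_h1 : θ ≤ 1) : 0 < cc n θ := by
  have a := logn_pos hn
  have b := dl_pos (n := n) (by omega)
  have : cc n θ = Real.log n + θ * dl n := by simp only [cc, dl]; ring
  rw [this]; positivity

lemma cc_mono {n : ℕ} (hn : 2 ≤ n) {θ : ℝ} (h0 : 0 ≤ θ) (h1 : θ ≤ 1) : cc n θ ≤ cc (n + 1) θ := by
  have := cc_succ n θ
  have a := dl_pos (n := n) (by omega)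
  have b := dl_pos (n := n + 1) (by omega)
  nlinarith [mul_nonneg h0 b.le, mul_nonneg (sub_nonneg.mpr h1) a.le]

lemma cc_concave {n : ℕ} (hn : 2 ≤ n) {θ : ℝ} (h0 : 0 ≤ θ) (h1 : θ ≤ 1) :
    cc (n + 2) θ + cc n θ ≤ 2 * cc (n + 1) θ := by
  have e1 := cc_succ n θ
  have e2 := cc_succ (n + 1) θ
  have a := dl_anti (n := n) (by omega)
  have b := dl_anti (n := n + 1) (by omega)
  nlinarith [mul_nonneg h0 (sub_nonneg.mpr b), mul_nonneg (sub_nonneg.mpr h1) (sub_nonneg.mpr a)]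

lemma cc_inv_convex {n : ℕ} (hn : 2 ≤ n) {θ : ℝ} (h0 : 0 ≤ θ) (h1 : θ ≤ 1) :
    2 * (cc (n + 1) θ)⁻¹ ≤ (cc (n + 2) θ)⁻¹ + (cc n θ)⁻¹ := by
  have p0 := cc_pos hn h0 h1
  have p1 := cc_pos (n := n + 1) (by omega) h0 h1
  have p2 := cc_pos (n := n + 2) (by omega) h0 h1
  have c := cc_concave hn h0 h1
  generalize cc n θ = x at *
  generalize cc (n+1) θ = y at *
  generalize cc (n+2) θ = z at *
  have h : 2 * y⁻¹ ≤ 4 / (z + x) := by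
    rw [← div_eq_mul_inv, div_le_div_iff₀ p1 (by positivity)]; linarith
  refine h.trans ?_
  have : z⁻¹ + x⁻¹ = (z + x) / (z * x) := by field_simp; ring
  rw [this, div_le_div_iff₀ (by positivity) (by positivity)]
  nlinarith [sq_nonneg (z - x)]

lemma cc_inv_gamma {n : ℕ} (hn : 2 ≤ n) {θ : ℝ} (h0 : 0 ≤ θ) (h1 : θ ≤ 1) :
    (cc n θ)⁻¹ - (cc (n + 1) θ)⁻¹ ≤ 4 * ((cc (n + 1) θ)⁻¹ - (cc (n + 2) θ)⁻¹) := by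
  have p0 := cc_pos hn h0 h1
  have p1 := cc_pos (n := n + 1) (by omega) h0 h1
  have p2 := cc_pos (n := n + 2) (by omega) h0 h1
  have m1 := cc_mono hn h0 h1
  have hd : cc (n + 1) θ - cc n θ ≤ 2 * (cc (n + 2) θ - cc (n + 1) θ) := by
    rw [cc_succ n θ, cc_succ (n + 1) θ]
    have a := dl_half (n := n) (by omega)
    have b := dl_half (n := n + 1) (by omega)
    nlinarith [mul_nonneg h0 (sub_nonneg.mpr b), mul_nonneg (sub_nonneg.mpr h1) (sub_nonneg.mpr a)]
  have hh : cc (n + 2) θ ≤ 2 * cc n θ := by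
    have a := logn_half hn
    have b := logn_half (n := n + 1) (by omega)
    simp only [cc]
    push_cast at *
    have e3 : (n : ℝ) + 1 + 2 = n + 2 + 1 := by ring
    rw [e3] at b
    nlinarith [mul_nonneg h0 (sub_nonneg.mpr b), mul_nonneg (sub_nonneg.mpr h1) (sub_nonneg.mpr a)]
  generalize cc n θ = x at *
  generalize cc (n+1) θ = y at *
  generalize cc (n+2) θ = z at *
  have e1 : x⁻¹ - y⁻¹ = (y - x) / (x * y) := by field_simp
  have e2 : 4 * (y⁻¹ - z⁻¹) = 4 * (z - y) / (y * z) := by field_simp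
  rw [e1, e2, div_le_div_iff₀ (by positivity) (by positivity)]
  have : (y - x) * z ≤ (2 * (z - y)) * (2 * x) := by
    apply mul_le_mul hd hh p2.le; nlinarith
  nlinarith

lemma cc_inv_cont {n : ℕ} (hn : 2 ≤ n) :
    IntervalIntegrable (fun θ => (cc n θ)⁻¹) MeasureTheory.volume 0 1 := by
  apply ContinuousOn.intervalIntegrable
  rw [Set.uIcc_of_le zero_le_one]
  apply ContinuousOn.inv₀
  · unfold cc; fun_prop
  · intro θ h; exact (cc_pos hn h.1 h.2).ne'

lemma q_eq_div {n : ℕ} (hn : 2 ≤ n) :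
    q n = (Real.log (Real.log ((n : ℝ) + 1)) - Real.log (Real.log n)) / dl n := by
  have a := logn_pos hn
  have b := logn_pos (n := n + 1) (by omega)
  push_cast at b
  have h0 : (0:ℝ) < n := by exact_mod_cast (by omega : 0 < n)
  rw [q, Real.log_div a.ne' b.ne', dl, Real.log_div h0.ne' (by positivity)]
  rw [← neg_sub, ← neg_sub (Real.log ((n : ℝ) + 1)), neg_div_neg_eq]

lemma q_int {n : ℕ} (hn : 2 ≤ n) : q n = ∫ θ in (0:ℝ)..1, (cc n θ)⁻¹ := by
  have d := dl_pos (n := n) (by omega)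
  have key : ∫ θ in (0:ℝ)..1, (cc n θ)⁻¹ =
      Real.log (cc n 1) / dl n - Real.log (cc n 0) / dl n := by
    apply intervalIntegral.integral_eq_sub_of_hasDerivAt (f := fun θ => Real.log (cc n θ) / dl n) _ (cc_inv_cont hn)
    intro θ hθ
    rw [Set.uIcc_of_le zero_le_one] at hθ
    have p := cc_pos hn hθ.1 hθ.2
    have h1 : HasDerivAt (cc n) (dl n) θ := by
      have e : cc n = fun θ => Real.log n + θ * dl n := by funext x; simp only [cc, dl]; ring
      rw [e]
      simpa using ((hasDerivAt_id θ).mul_const (dl n)).const_add (Real.log n)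
    have := (h1.log p.ne').div_const (dl n)
    have e : (cc n θ)⁻¹ = dl n / cc n θ / dl n := by
      have := p.ne'
      have := d.ne'
      field_simp
    rw [e]; exact this
  rw [key, q_eq_div hn, sub_div]
  simp [cc]

lemma q_pos {n : ℕ} (hn : 2 ≤ n) : 0 < q n := by
  rw [q_eq_div hn]
  have a := logn_pos hn
  have d := dl_pos (n := n) (by omega)
  apply div_pos _ d
  apply sub_pos.mpr
  apply Real.log_lt_log a
  unfold dl at d; linarith

lemma q_anti {n : ℕ} (hn : 2 ≤ n) : q (n + 1) ≤ q n := by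
  rw [q_int hn, q_int (by omega : 2 ≤ n + 1)]
  apply intervalIntegral.integral_mono_on zero_le_one (cc_inv_cont (by omega)) (cc_inv_cont hn)
  intro θ hθ
  exact inv_anti₀ (cc_pos hn hθ.1 hθ.2) (cc_mono hn hθ.1 hθ.2)

lemma q_convex {n : ℕ} (hn : 2 ≤ n) : q (n + 1) - q (n + 2) ≤ q n - q (n + 1) := by
  have i0 := cc_inv_cont hn
  have i1 := cc_inv_cont (n := n + 1) (by omega)
  have i2 := cc_inv_cont (n := n + 2) (by omega)
  rw [q_int hn, q_int (by omega : 2 ≤ n + 1), q_int (by omega : 2 ≤ n + 2),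
    ← intervalIntegral.integral_sub i1 i2, ← intervalIntegral.integral_sub i0 i1]
  apply intervalIntegral.integral_mono_on zero_le_one (i1.sub i2) (i0.sub i1)
  intro θ hθ
  have := cc_inv_convex hn hθ.1 hθ.2
  linarith

lemma q_gamma {n : ℕ} (hn : 2 ≤ n) : q n - q (n + 1) ≤ 4 * (q (n + 1) - q (n + 2)) := by
  have i0 := cc_inv_cont hn
  have i1 := cc_inv_cont (n := n + 1) (by omega)
  have i2 := cc_inv_cont (n := n + 2) (by omega)
  rw [q_int hn, q_int (by omega : 2 ≤ n + 1), q_int (by omega : 2 ≤ n + 2),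
    ← intervalIntegral.integral_sub i1 i2, ← intervalIntegral.integral_sub i0 i1,
    ← intervalIntegral.integral_const_mul]
  apply intervalIntegral.integral_mono_on zero_le_one (i0.sub i1) ((i1.sub i2).const_mul 4)
  intro θ hθ
  exact cc_inv_gamma hn hθ.1 hθ.2

noncomputable def tau (k n : ℕ) (σ : ℝ) : ℝ :=
  Real.exp (k * Real.log (Real.log n) - σ * Real.log n)

lemma tau_pos (k n : ℕ) (σ : ℝ) : 0 < tau k n σ := Real.exp_pos _

lemma tau_succ {n : ℕ} (hn : 2 ≤ n) (k : ℕ) (σ : ℝ) :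
    tau k (n + 1) σ = Real.exp (-(dl n * (σ - q n * k))) * tau k n σ := by
  have d := dl_pos (n := n) (by omega)
  have h := q_eq_div hn
  rw [eq_div_iff d.ne'] at h
  have e : Real.log ((n : ℝ) + 1) = dl n + Real.log n := by simp [dl]
  rw [tau, tau, ← Real.exp_add]
  push_cast
  congr 1
  rw [← sub_eq_zero]
  have h2 : Real.log (Real.log ((n : ℝ) + 1)) = q n * dl n + Real.log (Real.log n) := by linarith
  rw [h2, e]; ring

lemma log3_gt : (1.08 : ℝ) < Real.log 3 := by
  have h : Real.log ((2:ℝ) ^ 11) ≤ Real.log ((3:ℝ) ^ 7) := Real.log_le_log (by norm_num) (by norm_num)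
  rw [Real.log_pow, Real.log_pow] at h
  have := Real.log_two_gt_d9
  push_cast at h
  linarith

lemma q_le {a b : ℕ} (ha : 2 ≤ a) (hab : a ≤ b) : q b ≤ q a := by
  induction b, hab using Nat.le_induction with
  | base => exact le_rfl
  | succ n hn ih => exact (q_anti (by omega)).trans ih

lemma q_diff {a b : ℕ} (ha : 2 ≤ a) (hab : a ≤ b) : q b - q (b + 1) ≤ q a - q (a + 1) := by
  induction b, hab using Nat.le_induction with
  | base => exact le_rfl
  | succ n hn ih => exact (q_convex (by omega)).trans ih

lemma exp_three (j : ℕ) : Real.exp (-(j * Real.log 3)) = 1 / 3 ^ j := by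
  rw [Real.exp_neg, ← Real.log_pow, Real.exp_log (by positivity), one_div]

lemma ratio_down {n : ℕ} (hn : 2 ≤ n) (k j : ℕ) (σ : ℝ)
    (h : j * ((n : ℝ) + 1) * Real.log 3 ≤ q n * k - σ) :
    tau k n σ ≤ 1 / 3 ^ j * tau k (n + 1) σ := by
  have d := dl_gt (n := n) (by omega)
  have d0 := dl_pos (n := n) (by omega)
  have l3 := log3_gt
  rw [tau_succ hn, ← mul_assoc, ← exp_three, ← Real.exp_add]
  apply le_mul_of_one_le_left (tau_pos _ _ _).le
  apply Real.one_le_exp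
  have h1 : (j * Real.log 3) * (((n : ℝ) + 1) * dl n) ≤ dl n * (q n * k - σ) := by nlinarith
  have h2 : (j * Real.log 3) * 1 ≤ (j * Real.log 3) * (((n : ℝ) + 1) * dl n) := by gcongr
  linarith

lemma sum_down {M k : ℕ} (hM : 2 ≤ M)
    (hD : (2 * (M : ℝ) + 3) * Real.log 3 ≤ (q M - q (M + 1)) * k) {σ : ℝ}
    (hσ : σ ≤ q M * k + ((M : ℝ) + 1) * Real.log 3) :
    ∑ n ∈ Finset.Ico 2 M, tau k n σ ≤ 9 / 26 * tau k M σ := by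
  have l3 := log3_gt
  have k0 : (0:ℝ) ≤ k := Nat.cast_nonneg k
  have r27 : ∀ n, 2 ≤ n → n + 2 ≤ M → tau k n σ ≤ 1 / 3 ^ 3 * tau k (n + 1) σ := by
    intro n hn hnM
    apply ratio_down hn
    obtain ⟨m, rfl⟩ : ∃ m, M = m + 2 := ⟨M - 2, by omega⟩
    have a1 := q_le hn (by omega : n ≤ m)
    have a2 := q_diff (a := m) (b := m + 2) (by omega) (by omega)
    have a3 := q_diff (a := m + 1) (b := m + 2) (by omega) (by omega)
    have a4 : 2 * (q (m + 2) - q (m + 2 + 1)) ≤ q n - q (m + 2) := by linarith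
    have a5 := mul_le_mul_of_nonneg_right a4 k0
    have a6 : (n : ℝ) + 2 ≤ ((m + 2 : ℕ) : ℝ) := by exact_mod_cast hnM
    have a7 : 3 * ((n : ℝ) + 1) * Real.log 3 ≤ (3 * ((m + 2 : ℕ) : ℝ) + 5) * Real.log 3 := by
      gcongr; linarith
    push_cast at *
    linarith
  have claim : ∀ n, 2 ≤ n → n + 1 ≤ M → ∑ i ∈ Finset.Ico 2 n, tau k i σ ≤ 1 / 26 * tau k n σ := by
    intro n hn
    induction n, hn using Nat.le_induction with
    | base => intro _; simp [(tau_pos _ _ _).le]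
    | succ n hn ih =>
      intro h
      rw [Finset.sum_Ico_succ_top hn]
      have := ih (by omega)
      have := r27 n hn (by omega)
      norm_num at *
      linarith
  rcases Nat.lt_or_ge 2 M with h | h
  · obtain ⟨m, rfl⟩ : ∃ m, M = m + 1 := ⟨M - 1, by omega⟩
    rw [Finset.sum_Ico_succ_top (by omega)]
    have c := claim m (by omega) le_rfl
    have r := ratio_down (n := m) (by omega) k 1 σ (by
      have a2 := mul_le_mul_of_nonneg_right (q_diff (a := m) (b := m + 1) (by omega) (by omega)) k0
      have a7 : ((m : ℝ) + 1) * Real.log 3 ≤ (((m + 1 : ℕ) : ℝ) + 2) * Real.log 3 :=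
        mul_le_mul_of_nonneg_right (by push_cast; linarith) (by linarith)
      push_cast at *
      linarith)
    norm_num at *
    linarith
  · rw [Finset.Ico_eq_empty (by omega)]
    simp [(tau_pos _ _ _).le]

lemma bern {p m : ℕ} (hp : 4 ≤ p) :
    6 * Real.log (1 + (m : ℝ) / 4) ≤ 3 / 2 * p * (Real.log ((p + m : ℕ) : ℝ) - Real.log p) := by
  have hp' : (4:ℝ) ≤ p := by exact_mod_cast hp
  have b := one_add_mul_self_le_rpow_one_add (s := (m : ℝ) / p) (by
    have : (0:ℝ) ≤ (m : ℝ) / p := by positivity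
    linarith) (p := (p : ℝ) / 4) (by linarith)
  have e : (p : ℝ) / 4 * ((m : ℝ) / p) = m / 4 := by field_simp
  rw [e] at b
  have b2 := Real.log_le_log (by positivity) b
  rw [Real.log_rpow (by positivity)] at b2
  have e2 : 1 + (m : ℝ) / p = ((p + m : ℕ) : ℝ) / p := by push_cast; field_simp
  rw [e2, Real.log_div (by positivity) (by positivity)] at b2
  linarith

lemma up_term {M k : ℕ} (hM : 2 ≤ M)
    (hD : (2 * (M : ℝ) + 3) * Real.log 3 ≤ (q M - q (M + 1)) * k) {σ : ℝ}
    (hσ : q (M + 1) * k + ((M : ℝ) + 2) * Real.log 3 ≤ σ) (m : ℕ) :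
    tau k (M + 2 + m) σ ≤ 1 / 3 * (4 / (4 + (m : ℝ))) ^ 6 * tau k (M + 1) σ := by
  have l3 := log3_gt
  have k0 : (0:ℝ) ≤ k := Nat.cast_nonneg k
  have hM' : (2:ℝ) ≤ M := by exact_mod_cast hM
  have s1 : tau k (M + 2) σ ≤ 1 / 3 * tau k (M + 1) σ := by
    rw [show M + 2 = (M + 1) + 1 from rfl, tau_succ (by omega)]
    have d := dl_gt (n := M + 1) (by omega)
    have d0 := dl_pos (n := M + 1) (by omega)
    have := exp_three 1
    rw [pow_one] at this
    rw [← this]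
    apply mul_le_mul_of_nonneg_right _ (tau_pos _ _ _).le
    apply Real.exp_le_exp.mpr
    push_cast at *
    have h1 := mul_le_mul_of_nonneg_left (by linarith : ((M : ℝ) + 2) * Real.log 3 ≤ σ - q (M + 1) * k) d0.le
    nlinarith
  have hS : ∀ n, M + 2 ≤ n → 3 / 2 * ((M : ℝ) + 2) ≤ σ - q n * k := by
    intro n hn
    have a1 := mul_le_mul_of_nonneg_right (q_le (by omega) hn) k0
    have a2 := mul_le_mul_of_nonneg_right (q_gamma hM) k0
    nlinarith
  have s2 : ∀ m : ℕ, tau k (M + 2 + m) σ ≤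
      Real.exp (-(3 / 2 * ((M : ℝ) + 2) * (Real.log ((M + 2 + m : ℕ) : ℝ) - Real.log ((M + 2 : ℕ) : ℝ)))) *
        tau k (M + 2) σ := by
    intro m
    induction m with
    | zero => simp
    | succ m ih =>
      rw [show M + 2 + (m + 1) = (M + 2 + m) + 1 from rfl, tau_succ (by omega)]
      have d0 := dl_pos (n := M + 2 + m) (by omega)
      calc _ ≤ Real.exp (-(dl (M + 2 + m) * (3 / 2 * ((M : ℝ) + 2)))) * _ := by
            apply mul_le_mul _ ih (tau_pos _ _ _).le (Real.exp_pos _).le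
            apply Real.exp_le_exp.mpr
            have := mul_le_mul_of_nonneg_left (hS (M + 2 + m) (by omega)) d0.le
            linarith
        _ = _ := by
            rw [← mul_assoc, ← Real.exp_add]
            congr 2
            rw [dl]; push_cast; ring
  refine (s2 m).trans ?_
  have hb := bern (p := M + 2) (m := m) (by omega)
  have e : Real.exp (-(6 * Real.log (1 + (m : ℝ) / 4))) = (4 / (4 + (m : ℝ))) ^ 6 := by
    have : (6:ℝ) * Real.log (1 + (m : ℝ) / 4) = Real.log ((1 + (m : ℝ) / 4) ^ 6) := by
      rw [Real.log_pow]; norm_num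
    rw [this, Real.exp_neg, Real.exp_log (by positivity), ← inv_pow]
    congr 1
    field_simp
  calc _ ≤ Real.exp (-(6 * Real.log (1 + (m : ℝ) / 4))) * (1 / 3 * tau k (M + 1) σ) := by
        apply mul_le_mul _ s1 (tau_pos _ _ _).le (Real.exp_pos _).le
        apply Real.exp_le_exp.mpr
        push_cast at *
        linarith
    _ = _ := by rw [e]; ring

lemma six_partial (K : ℕ) :
    ∑ m ∈ Finset.range K, (4 / (4 + (m : ℝ))) ^ 6 ≤ 75 / 51 := by
  have h : ∀ K : ℕ, ∑ m ∈ Finset.range (K + 6), (4 / (4 + (m : ℝ))) ^ 6 ≤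
      75 / 51 - 0.4096 / ((K : ℝ) + 9) := by
    intro K
    induction K with
    | zero => norm_num [Finset.sum_range_succ]
    | succ K ih =>
      rw [show K + 1 + 6 = (K + 6) + 1 by ring, Finset.sum_range_succ]
      have : (4 / (4 + ((K + 6 : ℕ) : ℝ))) ^ 6 ≤ 0.4096 / ((K : ℝ) + 9) - 0.4096 / ((K : ℝ) + 1 + 9) := by
        have e : 0.4096 / ((K : ℝ) + 9) - 0.4096 / ((K : ℝ) + 1 + 9) =
          0.4096 / (((K : ℝ) + 9) * (K + 10)) := by field_simp; ring
        rw [e, div_pow, div_le_div_iff₀ (by positivity) (by positivity)]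
        push_cast
        have hx : (0:ℝ) ≤ K := Nat.cast_nonneg K
        have e2 : (4 + ((K:ℝ) + 6)) = K + 10 := by ring
        rw [e2]
        have h4 : (10:ℝ) ^ 4 ≤ ((K : ℝ) + 10) ^ 4 := by gcongr; linarith
        have h5 : ((K : ℝ) + 9) * (K + 10) ≤ (K + 10) ^ 2 := by nlinarith
        calc (4:ℝ) ^ 6 * (((K : ℝ) + 9) * (K + 10)) ≤ (0.4096 * 10 ^ 4) * ((K : ℝ) + 10) ^ 2 := by
              norm_num; linarith
          _ ≤ (0.4096 * ((K : ℝ) + 10) ^ 4) * ((K : ℝ) + 10) ^ 2 := by gcongr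
          _ = _ := by ring
      push_cast at *
      linarith
  calc _ ≤ ∑ m ∈ Finset.range (K + 6), (4 / (4 + (m : ℝ))) ^ 6 := by
        apply Finset.sum_le_sum_of_subset_of_nonneg
        · apply Finset.range_mono; omega
        · intros; positivity
    _ ≤ _ := h K
    _ ≤ 75 / 51 := by
        have : (0:ℝ) ≤ 0.4096 / ((K : ℝ) + 9) := by positivity
        linarith

lemma sum_up {M k : ℕ} (hM : 2 ≤ M)
    (hD : (2 * (M : ℝ) + 3) * Real.log 3 ≤ (q M - q (M + 1)) * k) {σ : ℝ}
    (hσ : q (M + 1) * k + ((M : ℝ) + 2) * Real.log 3 ≤ σ) (K : ℕ) :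
    ∑ m ∈ Finset.range K, tau k (M + 2 + m) σ ≤ 25 / 51 * tau k (M + 1) σ := by
  calc _ ≤ ∑ m ∈ Finset.range K, 1 / 3 * (4 / (4 + (m : ℝ))) ^ 6 * tau k (M + 1) σ :=
        Finset.sum_le_sum fun m _ => up_term hM hD hσ m
    _ = (1 / 3 * ∑ m ∈ Finset.range K, (4 / (4 + (m : ℝ))) ^ 6) * tau k (M + 1) σ := by
        rw [Finset.mul_sum, Finset.sum_mul]
    _ ≤ _ := by
        apply mul_le_mul_of_nonneg_right _ (tau_pos _ _ _).le
        have := six_partial K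
        linarith

lemma norm_log_le {z : ℂ} {c : ℝ} (hz : ‖z‖ ≤ c) (hc : c < 1) :
    ‖Complex.log (1 + z)‖ ≤ -Real.log (1 - c) := by
  have hz1 : ‖z‖ < 1 := hz.trans_lt hc
  have h1 := Complex.hasSum_taylorSeries_neg_log (z := -z) (by simpa using hz1)
  have h2 := Complex.hasSum_taylorSeries_neg_log (z := (c : ℂ)) (by
    rw [Complex.norm_real, Real.norm_of_nonneg ((norm_nonneg z).trans hz)]; exact hc)
  have h3 := Complex.hasSum_re h2
  have e : (-Complex.log (1 - (c : ℂ))).re = -Real.log (1 - c) := by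
    rw [Complex.neg_re, ← Complex.ofReal_one, ← Complex.ofReal_sub,
      ← Complex.ofReal_log (by linarith), Complex.ofReal_re]
  rw [e] at h3
  have := tsum_of_norm_bounded h3 (f := fun n : ℕ => (-z) ^ n / (n : ℂ)) (by
    intro n
    have e2 : ((c : ℂ) ^ n / (n : ℂ)).re = c ^ n / n := by
      rw [← Complex.ofReal_pow, ← Complex.ofReal_natCast, ← Complex.ofReal_div, Complex.ofReal_re]
    rw [e2, norm_div, norm_pow, norm_neg, Complex.norm_natCast]
    gcongr)
  rw [h1.tsum_eq] at this
  simpa using this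

noncomputable def TT (k n : ℕ) (s : ℂ) : ℂ :=
  Complex.exp ((k : ℂ) * (Real.log (Real.log n) : ℝ) - s * (Real.log n : ℝ))

lemma TT_norm (k n : ℕ) (s : ℂ) : ‖TT k n s‖ = tau k n s.re := by
  rw [TT, Complex.norm_exp, tau, Complex.sub_re, ← Complex.ofReal_natCast k, Complex.re_ofReal_mul,
    Complex.ofReal_re, Complex.re_mul_ofReal]

lemma TT_ne (k n : ℕ) (s : ℂ) : TT k n s ≠ 0 := Complex.exp_ne_zero _

lemma TT_diff (k n : ℕ) : Differentiable ℂ (TT k n) := by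
  unfold TT; fun_prop

lemma logMul_iter (k n : ℕ) : (LSeries.logMul^[k] (1 : ℕ → ℂ)) n = (Complex.log n) ^ k := by
  induction k with
  | zero => simp
  | succ k ih => rw [Function.iterate_succ_apply', LSeries.logMul, ih, pow_succ']

lemma term_eq {k n : ℕ} (hn : 2 ≤ n) (s : ℂ) :
    LSeries.term (LSeries.logMul^[k] (1 : ℕ → ℂ)) s n = TT k n s := by
  have h := logn_pos hn
  have n0 : (n : ℂ) ≠ 0 := by exact_mod_cast (by omega : n ≠ 0)
  rw [LSeries.term_of_ne_zero (by omega), logMul_iter, TT, Complex.exp_sub,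
    Complex.cpow_def_of_ne_zero n0, ← Complex.natCast_log]
  congr 1
  · rw [Complex.exp_nat_mul, ← Complex.ofReal_exp, Real.exp_log h]
  · rw [mul_comm]

lemma zeta_deriv_eq (k : ℕ) {s : ℂ} (hs : 1 < s.re) :
    iteratedDeriv k riemannZeta s = (-1) ^ k * LSeries (LSeries.logMul^[k] (1 : ℕ → ℂ)) s := by
  rw [← LSeries_iteratedDeriv k (by rw [LSeries.abscissaOfAbsConv_one]; exact_mod_cast hs)]
  apply Filter.EventuallyEq.iteratedDeriv_eq
  have : {z : ℂ | 1 < z.re} ∈ nhds s :=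
    (isOpen_lt continuous_const Complex.continuous_re).mem_nhds hs
  filter_upwards [this] with z hz
  exact (LSeries_one_eq_riemannZeta hz).symm

lemma absc_lt (k : ℕ) {s : ℂ} (hs : 1 < s.re) :
    LSeries.abscissaOfAbsConv (LSeries.logMul^[k] (1 : ℕ → ℂ)) < s.re := by
  rw [LSeries.absicssaOfAbsConv_logPowMul, LSeries.abscissaOfAbsConv_one]; exact_mod_cast hs

lemma series_split {k : ℕ} (hk : k ≠ 0) (M : ℕ) (hM : 2 ≤ M) {s : ℂ} (hs : 1 < s.re) :
    HasSum (fun m : ℕ => TT k (M + 2 + m) s)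
      (LSeries (LSeries.logMul^[k] (1 : ℕ → ℂ)) s - ∑ n ∈ Finset.Ico 2 M, TT k n s
        - TT k M s - TT k (M + 1) s) := by
  have hsum : LSeriesSummable (LSeries.logMul^[k] (1 : ℕ → ℂ)) s :=
    LSeriesSummable_of_abscissaOfAbsConv_lt_re (absc_lt k hs)
  have h := hsum.hasSum
  rw [← hasSum_nat_add_iff' (M + 2)] at h
  have e : ∑ i ∈ Finset.range (M + 2), LSeries.term (LSeries.logMul^[k] (1 : ℕ → ℂ)) s i =
      ∑ n ∈ Finset.Ico 2 M, TT k n s + TT k M s + TT k (M + 1) s := by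
    rw [← Finset.sum_range_add_sum_Ico _ (by omega : 2 ≤ M + 2)]
    have z : ∑ i ∈ Finset.range 2, LSeries.term (LSeries.logMul^[k] (1 : ℕ → ℂ)) s i = 0 := by
      rw [Finset.sum_range_succ, Finset.sum_range_one, LSeries.term_zero,
        LSeries.term_of_ne_zero one_ne_zero, logMul_iter]
      simp [hk]
    rw [z, zero_add, Finset.sum_congr rfl (fun n hn => term_eq (Finset.mem_Ico.mp hn).1 s),
      Finset.sum_Ico_succ_top (by omega), Finset.sum_Ico_succ_top (by omega)]
  rw [e] at h
  have e2 : (fun m : ℕ => TT k (M + 2 + m) s) =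
      fun n => LSeries.term (LSeries.logMul^[k] (1 : ℕ → ℂ)) s (n + (M + 2)) := by
    funext m
    rw [term_eq (by omega), add_comm]
  rw [e2]
  have e5 : LSeries (LSeries.logMul^[k] (1 : ℕ → ℂ)) s - ∑ n ∈ Finset.Ico 2 M, TT k n s
        - TT k M s - TT k (M + 1) s = (∑' n, LSeries.term (LSeries.logMul^[k] (1 : ℕ → ℂ)) s n) -
        (∑ n ∈ Finset.Ico 2 M, TT k n s + TT k M s + TT k (M + 1) s) := by
    unfold LSeries; ring
  rw [e5]
  exact h

noncomputable def gm (k M : ℕ) (s : ℂ) : ℂ := (∑ n ∈ Finset.Ico 2 M, TT k n s) / TT k M s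

noncomputable def hp (k M : ℕ) (s : ℂ) : ℂ :=
  (LSeries (LSeries.logMul^[k] (1 : ℕ → ℂ)) s - ∑ n ∈ Finset.Ico 2 M, TT k n s
        - TT k M s - TT k (M + 1) s) / TT k (M + 1) s

lemma gm_bound {M k : ℕ} (hM : 2 ≤ M)
    (hD : (2 * (M : ℝ) + 3) * Real.log 3 ≤ (q M - q (M + 1)) * k) {s : ℂ}
    (hσ : s.re ≤ q M * k + ((M : ℝ) + 1) * Real.log 3) : ‖gm k M s‖ ≤ 9 / 26 := by
  rw [gm, norm_div, TT_norm, div_le_iff₀ (tau_pos _ _ _)]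
  refine (norm_sum_le _ _).trans ?_
  simp only [TT_norm]
  exact sum_down hM hD hσ

lemma hp_bound {M k : ℕ} (hM : 2 ≤ M) (hk : k ≠ 0)
    (hD : (2 * (M : ℝ) + 3) * Real.log 3 ≤ (q M - q (M + 1)) * k) {s : ℂ} (hs : 1 < s.re)
    (hσ : q (M + 1) * k + ((M : ℝ) + 2) * Real.log 3 ≤ s.re) : ‖hp k M s‖ ≤ 25 / 51 := by
  rw [hp, norm_div, TT_norm, div_le_iff₀ (tau_pos _ _ _)]
  have h := series_split hk M hM hs
  refine le_of_tendsto h.tendsto_sum_nat.norm (Filter.Eventually.of_forall fun K => ?_)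
  refine (norm_sum_le _ _).trans ?_
  simp only [TT_norm]
  exact sum_up hM hD hσ K

lemma gm_diff (k M : ℕ) : Differentiable ℂ (gm k M) := by
  unfold gm
  apply Differentiable.div _ (TT_diff k M) (TT_ne k M)
  exact Differentiable.fun_sum fun n _ => TT_diff k n

lemma hp_diff (k M : ℕ) {s : ℂ} (hs : 1 < s.re) : DifferentiableAt ℂ (hp k M) s := by
  unfold hp
  have h1 : DifferentiableAt ℂ (LSeries (LSeries.logMul^[k] (1 : ℕ → ℂ))) s :=
    (LSeries_hasDerivAt (absc_lt k hs)).differentiableAt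
  have h2 : DifferentiableAt ℂ (fun s => ∑ n ∈ Finset.Ico 2 M, TT k n s) s :=
    (Differentiable.fun_sum fun n _ => TT_diff k n) s
  exact ((((h1.sub h2).sub (TT_diff k M s)).sub (TT_diff k (M + 1) s))).div (TT_diff k (M+1) s)
    (TT_ne k (M+1) s)

lemma TT_ratio {k M : ℕ} (hM : 2 ≤ M) (s : ℂ) :
    TT k M s = Complex.exp ((dl M : ℝ) * (s - (q M * k : ℝ))) * TT k (M + 1) s := by
  have d := dl_pos (n := M) (by omega)
  have h := q_eq_div hM
  rw [eq_div_iff d.ne'] at h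
  have e : Real.log ((M : ℝ) + 1) = dl M + Real.log M := by simp [dl]
  have h2 : Real.log (Real.log ((M : ℝ) + 1)) = q M * dl M + Real.log (Real.log M) := by linarith
  rw [TT, TT, ← Complex.exp_add]
  congr 1
  push_cast
  rw [h2, e]
  push_cast
  ring

/-- zeros are solutions of the exponential equation -/
lemma zero_iff {M k : ℕ} (hM : 2 ≤ M) {s : ℂ} (hs : 1 < s.re)
    (hg : ‖gm k M s‖ ≤ 9 / 26) (hh : ‖hp k M s‖ ≤ 25 / 51) :
    iteratedDeriv k riemannZeta s = 0 ↔ ∃ j : ℤ,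
      (q M * k : ℝ) + (Complex.log (1 + hp k M s) - Complex.log (1 + gm k M s)
        + (2 * j + 1) * Real.pi * Complex.I) / (dl M : ℝ) = s := by
  have d := dl_pos (n := M) (by omega)
  have dc : ((dl M : ℝ) : ℂ) ≠ 0 := by exact_mod_cast d.ne'
  have ng : 1 + gm k M s ≠ 0 := by
    intro h
    have : gm k M s = -1 := by linear_combination h
    rw [this, norm_neg, norm_one] at hg; norm_num at hg
  have nh : 1 + hp k M s ≠ 0 := by
    intro h
    have : hp k M s = -1 := by linear_combination h
    rw [this, norm_neg, norm_one] at hh; norm_num at hh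
  have tM := TT_ne k M s
  have tM1 := TT_ne k (M + 1) s
  have e1 : LSeries (LSeries.logMul^[k] (1 : ℕ → ℂ)) s =
      TT k M s * (1 + gm k M s) + TT k (M + 1) s * (1 + hp k M s) := by
    rw [gm, hp]; field_simp; ring
  have e2 : LSeries (LSeries.logMul^[k] (1 : ℕ → ℂ)) s = TT k (M + 1) s *
      (Complex.exp ((dl M : ℝ) * (s - (q M * k : ℝ)) + Complex.log (1 + gm k M s))
        + Complex.exp (Complex.log (1 + hp k M s))) := by
    rw [e1, TT_ratio hM, Complex.exp_add, Complex.exp_log ng, Complex.exp_log nh]; ring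
  rw [zeta_deriv_eq k hs, e2]
  have e3 : (-1 : ℂ) ^ k ≠ 0 := by simp
  rw [mul_eq_zero, mul_eq_zero]
  simp only [e3, tM1, false_or]
  have e4 : -Complex.exp (Complex.log (1 + hp k M s)) =
      Complex.exp (Complex.log (1 + hp k M s) + Real.pi * Complex.I) := by
    rw [Complex.exp_add, Complex.exp_pi_mul_I]; ring
  rw [add_eq_zero_iff_eq_neg, e4, Complex.exp_eq_exp_iff_exists_int]
  apply exists_congr
  intro j
  rw [← sub_eq_iff_eq_add', eq_comm (a := _ + _ / _), ← sub_eq_iff_eq_add', eq_div_iff dc]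
  constructor
  · intro h; linear_combination h
  · intro h; linear_combination h

noncomputable def Phi (k M : ℕ) (j : ℤ) (s : ℂ) : ℂ :=
  (q M * k : ℝ) + (Complex.log (1 + hp k M s) - Complex.log (1 + gm k M s)
        + (2 * j + 1) * Real.pi * Complex.I) / (dl M : ℝ)

noncomputable def cen (k M : ℕ) (j : ℤ) : ℂ :=
  (q M * k : ℝ) + ((2 * j + 1) * Real.pi * Complex.I) / (dl M : ℝ)

lemma Phi_bound {M k : ℕ} (hM : 2 ≤ M) (j : ℤ) {s : ℂ}
    (hg : ‖gm k M s‖ ≤ 9 / 26) (hh : ‖hp k M s‖ ≤ 25 / 51) :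
    ‖Phi k M j s - cen k M j‖ ≤ Real.log 3 / dl M := by
  have d := dl_pos (n := M) (by omega)
  have e : Phi k M j s - cen k M j =
      (Complex.log (1 + hp k M s) - Complex.log (1 + gm k M s)) / (dl M : ℝ) := by
    rw [Phi, cen]; ring
  rw [e, norm_div, Complex.norm_real, Real.norm_of_nonneg d.le]
  gcongr
  refine (norm_sub_le _ _).trans ?_
  have a := norm_log_le hh (by norm_num)
  have b := norm_log_le hg (by norm_num)
  have e3 : Real.log 3 = -Real.log (1 - 25 / 51) + -Real.log (1 - 9 / 26) := by
    rw [← neg_add, ← Real.log_mul (by norm_num) (by norm_num), ← Real.log_inv]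
    norm_num
  linarith

lemma cen_re (k M : ℕ) (j : ℤ) : (cen k M j).re = q M * k := by
  have : cen k M j = ((q M * k : ℝ) : ℂ) + (((2 * j + 1) * Real.pi / dl M : ℝ) : ℂ) * Complex.I := by
    rw [cen]; push_cast; ring
  rw [this]; simp [-Complex.ofReal_div, -Complex.ofReal_mul]

lemma cen_im (k M : ℕ) (j : ℤ) : (cen k M j).im = (2 * j + 1) * Real.pi / dl M := by
  have : cen k M j = ((q M * k : ℝ) : ℂ) + (((2 * j + 1) * Real.pi / dl M : ℝ) : ℂ) * Complex.I := by
    rw [cen]; push_cast; ring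
  rw [this]; simp [-Complex.ofReal_div, -Complex.ofReal_mul]

lemma exists_roots {M k : ℕ} (hM : 2 ≤ M) (hk : 3 ≤ k)
    (hex : q (M + 1) * k + ((M : ℝ) + 2) * Real.log 3 <
      q M * k - ((M : ℝ) + 1) * Real.log 3) :
    ∃ z : ℤ → ℂ, (∀ j, |dl M * (z j).im - (2 * j + 1) * Real.pi| < Real.pi) ∧
      ∀ s : ℂ, (iteratedDeriv k riemannZeta s = 0 ∧
          q M * k - ((M : ℝ) + 1) * Real.log 3 ≤ s.re ∧
          s.re ≤ q M * k + ((M : ℝ) + 1) * Real.log 3) ↔ ∃ j, z j = s := by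
  have d := dl_pos (n := M) (by omega)
  have dg := dl_gt (n := M) (by omega)
  have l3 := log3_gt
  have hM' : (2:ℝ) ≤ M := by exact_mod_cast hM
  have hD : (2 * (M : ℝ) + 3) * Real.log 3 ≤ (q M - q (M + 1)) * k := by linarith
  have hre : ∀ s : ℂ, q M * k - ((M : ℝ) + 1) * Real.log 3 ≤ s.re → 1 < s.re := by
    intro s hs
    have := mul_nonneg (q_pos (n := M + 1) (by omega)).le (Nat.cast_nonneg (α := ℝ) k)
    nlinarith
  have hG : ∀ s : ℂ, s.re ≤ q M * k + ((M : ℝ) + 1) * Real.log 3 → ‖gm k M s‖ ≤ 9 / 26 :=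
    fun s hs => gm_bound hM hD hs
  have hH : ∀ s : ℂ, q M * k - ((M : ℝ) + 1) * Real.log 3 ≤ s.re → ‖hp k M s‖ ≤ 25 / 51 :=
    fun s hs => hp_bound hM (by omega) hD (hre s hs) (hex.le.trans hs)
  have hrR : Real.log 3 / dl M < ((M : ℝ) + 1) * Real.log 3 := by
    rw [div_lt_iff₀ d]; nlinarith
  have hball : ∀ (j : ℤ) (s : ℂ), ‖s - cen k M j‖ < ((M : ℝ) + 1) * Real.log 3 →
      q M * k - ((M : ℝ) + 1) * Real.log 3 ≤ s.re ∧
          s.re ≤ q M * k + ((M : ℝ) + 1) * Real.log 3 := by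
    intro j s hs
    have := (Complex.abs_re_le_norm (s - cen k M j)).trans_lt hs
    rw [Complex.sub_re, cen_re, abs_lt] at this
    constructor <;> linarith
  have slit : ∀ {u : ℂ}, ‖u‖ < 1 → 1 + u ∈ Complex.slitPlane := by
    intro u hu
    left
    have := (Complex.abs_re_le_norm u).trans_lt hu
    rw [abs_lt] at this
    simp; linarith
  have hfix : ∀ j : ℤ, ∃! s : ℂ, ‖s - cen k M j‖ < ((M : ℝ) + 1) * Real.log 3 ∧
      Phi k M j s = s := by
    intro j
    apply fixed_ball (r := Real.log 3 / dl M) (by positivity) hrR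
    · intro s hs
      rw [mem_ball_iff_norm] at hs
      obtain ⟨h1, h2⟩ := hball j s hs
      apply DifferentiableAt.differentiableWithinAt
      unfold Phi
      have a1 : DifferentiableAt ℂ (fun s => Complex.log (1 + hp k M s)) s :=
        ((hp_diff k M (hre s h1)).const_add 1).clog (slit ((hH s h1).trans_lt (by norm_num)))
      have a2 : DifferentiableAt ℂ (fun s => Complex.log (1 + gm k M s)) s :=
        ((gm_diff k M s).const_add 1).clog (slit ((hG s h2).trans_lt (by norm_num)))
      exact (((a1.sub a2).add_const _).div_const _).const_add _
    · intro s hs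
      obtain ⟨h1, h2⟩ := hball j s hs
      exact Phi_bound hM j (hG s h2) (hH s h1)
  choose z hz huniq using hfix
  have hz2 : ∀ j, ‖z j - cen k M j‖ ≤ Real.log 3 / dl M := by
    intro j
    obtain ⟨h1, h2⟩ := hball j (z j) (hz j).1
    have := Phi_bound hM j (hG _ h2) (hH _ h1)
    rwa [(hz j).2] at this
  refine ⟨z, ?_, ?_⟩
  · intro j
    have h := (Complex.abs_im_le_norm (z j - cen k M j)).trans (hz2 j)
    rw [Complex.sub_im, cen_im] at h
    have e : dl M * (z j).im - (2 * j + 1) * Real.pi =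
        dl M * ((z j).im - (2 * j + 1) * Real.pi / dl M) := by field_simp
    rw [e, abs_mul, abs_of_pos d]
    rw [le_div_iff₀ d] at h
    have : Real.log 3 ≤ 3 - 1 := Real.log_le_sub_one_of_pos (by norm_num)
    have := Real.pi_gt_three
    linarith
  · intro s
    constructor
    · rintro ⟨h0, h1, h2⟩
      obtain ⟨j, hj⟩ := (zero_iff hM (hre s h1) (hG s h2) (hH s h1)).mp h0
      refine ⟨j, (huniq j s ⟨?_, hj⟩).symm⟩
      have := Phi_bound hM j (hG s h2) (hH s h1)
      have hj' : Phi k M j s = s := hj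
      rw [hj'] at this
      exact this.trans_lt hrR
    · rintro ⟨j, rfl⟩
      obtain ⟨h1, h2⟩ := hball j (z j) (hz j).1
      exact ⟨(zero_iff hM (hre _ h1) (hG _ h2) (hH _ h1)).mpr ⟨j, (hz j).2⟩, h1, h2⟩

lemma count_aux {δ : ℝ} (hδ : 0 < δ) (z : ℤ → ℂ)
    (hz : ∀ j : ℤ, |δ * (z j).im - (2 * j + 1) * Real.pi| < Real.pi) {T : ℝ} (hT : 0 < T) :
    |(((z '' {j | 0 < (z j).im ∧ (z j).im ≤ T}).ncard : ℕ) : ℝ) - T * δ / (2 * Real.pi)| ≤ 2 := by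
  have hpi := Real.pi_pos
  have lo : ∀ j : ℤ, 2 * j * Real.pi < δ * (z j).im := by
    intro j; have := (abs_lt.mp (hz j)).1; linarith
  have hi : ∀ j : ℤ, δ * (z j).im < 2 * (j + 1) * Real.pi := by
    intro j; have := (abs_lt.mp (hz j)).2; linarith
  have inj : Function.Injective z := by
    have step : ∀ a b : ℤ, z a = z b → a ≤ b := by
      intro a b hab
      have h1 := lo a
      have h2 := hi b
      rw [hab] at h1
      have h3 : (a : ℝ) < b + 1 := by nlinarith
      have : a < b + 1 := by exact_mod_cast h3
      omega
    intro a b hab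
    exact le_antisymm (step a b hab) (step b a hab.symm)
  rw [Set.ncard_image_of_injective _ inj]
  set X := T * δ / (2 * Real.pi) with hX
  have hX' : X * (2 * Real.pi) = δ * T := by rw [hX]; field_simp
  have X0 : 0 < X := by positivity
  have f0 : 0 ≤ ⌊X⌋ := Int.floor_nonneg.mpr X0.le
  have f1 := Int.floor_le X
  have f2 := Int.lt_floor_add_one X
  set J := {j : ℤ | 0 < (z j).im ∧ (z j).im ≤ T} with hJ
  have sub1 : ((Finset.Ico 0 ⌊X⌋ : Finset ℤ) : Set ℤ) ⊆ J := by
    intro j hj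
    rw [Finset.coe_Ico, Set.mem_Ico] at hj
    have j0 : (0:ℝ) ≤ j := by exact_mod_cast hj.1
    have j1 : (j : ℝ) + 1 ≤ ⌊X⌋ := by exact_mod_cast hj.2
    constructor
    · have := lo j
      have h : 0 < δ * (z j).im := lt_of_le_of_lt (by positivity) this
      exact pos_of_mul_pos_right h hδ.le
    · have := hi j
      have h : δ * (z j).im ≤ δ * T := by nlinarith
      exact le_of_mul_le_mul_left h hδ
  have sub2 : J ⊆ ((Finset.Icc 0 ⌊X⌋ : Finset ℤ) : Set ℤ) := by
    rintro j ⟨ha, hb⟩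
    rw [Finset.coe_Icc, Set.mem_Icc]
    constructor
    · have := hi j
      have h : 0 < δ * (z j).im := by positivity
      have h3 : (0:ℝ) < j + 1 := by
        by_contra hc
        push Not at hc
        nlinarith
      have : (0:ℤ) < j + 1 := by exact_mod_cast h3
      omega
    · apply Int.le_floor.mpr
      have := lo j
      have h : δ * (z j).im ≤ δ * T := by gcongr
      nlinarith
  have n1 := Set.ncard_le_ncard sub1 ((Finset.finite_toSet _).subset sub2)
  have n2 := Set.ncard_le_ncard sub2 (Finset.finite_toSet _)
  rw [Set.ncard_coe_finset, Int.card_Ico] at n1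
  rw [Set.ncard_coe_finset, Int.card_Icc] at n2
  have m1 : ⌊X⌋ ≤ (J.ncard : ℤ) := by omega
  have m2 : (J.ncard : ℤ) ≤ ⌊X⌋ + 1 := by omega
  have m1' : (⌊X⌋ : ℝ) ≤ (J.ncard : ℝ) := by exact_mod_cast m1
  have m2' : (J.ncard : ℝ) ≤ ⌊X⌋ + 1 := by exact_mod_cast m2
  rw [abs_le]
  constructor <;> linarith

/-- If the critical strip `S_M^k` exists, then the counting function `N_M^k(T)` of zeros
of the `k`-th derivative of the Riemann zeta function in `S_M^k` with `0 < Im ρ ≤ T`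
satisfies `N_M^k(T) = T (log(M+1) - log M)/(2π) + O(1)`. -/
theorem zero_count_asymptotic (M k : ℕ) (hM : 2 ≤ M) (hk : 3 ≤ k)
    (hex : q (M + 1) * k + ((M : ℝ) + 2) * Real.log 3 <
      q M * k - ((M : ℝ) + 1) * Real.log 3) :
    ∃ C : ℝ, ∀ T : ℝ, 0 < T →
      |(({ρ : ℂ | iteratedDeriv k riemannZeta ρ = 0 ∧
          q M * k - ((M : ℝ) + 1) * Real.log 3 ≤ ρ.re ∧
          ρ.re ≤ q M * k + ((M : ℝ) + 1) * Real.log 3 ∧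
          0 < ρ.im ∧ ρ.im ≤ T}.ncard : ℝ)) -
        T * (Real.log ((M : ℝ) + 1) - Real.log M) / (2 * Real.pi)| ≤ C := by
  obtain ⟨z, hz, hzero⟩ := exists_roots hM hk hex
  refine ⟨2, fun T hT => ?_⟩
  have hset : {ρ : ℂ | iteratedDeriv k riemannZeta ρ = 0 ∧
          q M * k - ((M : ℝ) + 1) * Real.log 3 ≤ ρ.re ∧
          ρ.re ≤ q M * k + ((M : ℝ) + 1) * Real.log 3 ∧
          0 < ρ.im ∧ ρ.im ≤ T} = z '' {j | 0 < (z j).im ∧ (z j).im ≤ T} := by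
    ext s
    constructor
    · rintro ⟨h0, h1, h2, h3, h4⟩
      obtain ⟨j, rfl⟩ := (hzero s).mp ⟨h0, h1, h2⟩
      exact ⟨j, ⟨h3, h4⟩, rfl⟩
    · rintro ⟨j, ⟨h3, h4⟩, rfl⟩
      obtain ⟨h0, h1, h2⟩ := (hzero (z j)).mpr ⟨j, rfl⟩
      exact ⟨h0, h1, h2, h3, h4⟩
  rw [hset]
  exact count_aux (dl_pos (n := M) (by omega)) z hz hT
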